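/- For every n ≥ 1, the space Qu₀(n) = {A ∈ Sym_{n+1}(ℂ) : det A ≠ 0}/ℂˣ of nonsingular quadrics in ℂPⁿ is path-connected and its fundamental group at any basepoint is isomorphic to the cyclic group ℤ/(n+1)ℤ. -/

import Mathlib

open Matrix

/-- The setoid identifying proportional matrices (quotient by the scaling action of `ℂˣ`)
on the subtype of matrices satisfying a property `P`. -/
def scalingSetoid (N : ℕ) (P : Matrix (Fin N) (Fin N) ℂ → Prop) :
    Setoid {A : Matrix (Fin N) (Fin N) ℂ // P A} where
  r A B := ∃ c : ℂˣ, (B : Matrix (Fin N) (Fin N) ℂ) = (c : ℂ) • (A : Matrix (Fin N) (Fin N) ℂ)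
  iseqv := by
    constructor
    · intro A; exact ⟨1, by simp⟩
    · rintro A B ⟨c, h⟩
      refine ⟨c⁻¹, ?_⟩
      rw [h, smul_smul]
      norm_cast
      simp
    · rintro A B C ⟨c, h⟩ ⟨d, h'⟩
      refine ⟨d * c, ?_⟩
      rw [h', h, smul_smul]
      norm_cast

/-- The quotient (with the quotient topology) of the space of matrices satisfying `P`
by the scaling action of `ℂˣ`. -/
abbrev MatQuot (N : ℕ) (P : Matrix (Fin N) (Fin N) ℂ → Prop) : Type :=
  Quotient (scalingSetoid N P)

open Polynomial in
lemma arc_avoid (p : ℂ[X]) (h0 : p.eval 0 ≠ 0) (h1 : p.eval 1 ≠ 0) (ε : ℝ) (hε : 0 < ε) :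
    ∃ s : ℝ, 0 < s ∧ s < ε ∧ ∀ t : unitInterval,
      p.eval ((t : ℂ) + Complex.I * s * t * (1 - t)) ≠ 0 := by
  have hp : p ≠ 0 := by rintro rfl; simp at h0
  let bad : Set ℝ := (fun r : ℂ => r.im / (r.re * (1 - r.re))) '' (p.rootSet ℂ)
  have hbad : bad.Finite := (p.rootSet_finite ℂ).image _
  have hinf : (Set.Ioo (0 : ℝ) ε).Infinite := Set.Ioo_infinite hε
  obtain ⟨s, hs, hsb⟩ := (hinf.sdiff hbad).nonempty
  refine ⟨s, hs.1, hs.2, fun t ht => ?_⟩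
  by_cases t0 : (t : ℝ) = 0
  · rw [t0] at ht; simp at ht; exact h0 ht
  by_cases t1 : (t : ℝ) = 1
  · rw [t1] at ht; simp at ht; exact h1 ht
  apply hsb
  refine ⟨((t : ℝ) : ℂ) + Complex.I * s * (t : ℝ) * (1 - (t : ℝ)), ?_, ?_⟩
  · rw [Polynomial.mem_rootSet]
    exact ⟨hp, by simpa using ht⟩
  · have : (t : ℝ) * (1 - t) ≠ 0 := mul_ne_zero t0 (fun h => t1 (by linarith))
    simp
    field_simp

lemma homotopic_of {Y : Type*} [TopologicalSpace Y] {a b : Y} (p q : Path a b)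
    (H : unitInterval × unitInterval → Y) (hH : Continuous H)
    (h0 : ∀ t, H (0, t) = p t) (h1 : ∀ t, H (1, t) = q t)
    (ha : ∀ s, H (s, 0) = a) (hb : ∀ s, H (s, 1) = b) : p.Homotopic q := by
  refine ⟨⟨⟨⟨H, hH⟩, h0, h1⟩, ?_⟩⟩
  intro s x hx
  rcases hx with rfl | hx
  · simpa using ha s
  · rw [Set.mem_singleton_iff] at hx; subst hx; simpa using hb s

/-- nonsingular symmetric matrices -/
abbrev SY (N : ℕ) : Type :=
  {A : Matrix (Fin N) (Fin N) ℂ // A.IsSymm ∧ A.det ≠ 0}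

lemma sy_path_ext_cont {N : ℕ} {a b : SY N} (γ : Path a b) :
    Continuous (fun t => (γ t : Matrix (Fin N) (Fin N) ℂ)) :=
  continuous_subtype_val.comp γ.continuous

instance locConvMat (N : ℕ) : LocallyConvexSpace ℝ (Matrix (Fin N) (Fin N) ℂ) :=
  inferInstanceAs (LocallyConvexSpace ℝ (Fin N → Fin N → ℂ))

/-- symmetric matrices as a submodule -/
def symSub (N : ℕ) : Submodule ℂ (Matrix (Fin N) (Fin N) ℂ) where
  carrier := {A | A.IsSymm}
  add_mem' := fun ha hb => ha.add hb
  zero_mem' := Matrix.isSymm_zero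
  smul_mem' := fun c _ h => h.smul c

open Polynomial Filter Topology in
lemma generic_path {N : ℕ} (W : Submodule ℂ (Matrix (Fin N) (Fin N) ℂ)) (k : Fin N)
    {a b : SY N} (ha : a.1 k k ≠ 0) (hb : b.1 k k ≠ 0) (γ : Path a b) (hW : ∀ t, (γ t).1 ∈ W) :
    ∃ δ : Path a b, γ.Homotopic δ ∧ (∀ t, (δ t).1 ∈ W) ∧ ∀ t, (δ t).1 k k ≠ 0 := by
  let g : C(unitInterval, Matrix (Fin N) (Fin N) ℂ) := ⟨fun t => (γ t).1, sy_path_ext_cont γ⟩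
  let good : C(unitInterval, Matrix (Fin N) (Fin N) ℂ) → Prop := fun f =>
    ∀ st ∈ (Set.univ : Set (unitInterval × unitInterval)),
      (g st.2 + ((st.1 : ℝ) : ℂ) • (f st.2 - g st.2)).det ≠ 0
  have hgood : ∀ᶠ f in 𝓝 g, good f := by
    apply isCompact_univ.eventually_forall_of_forall_eventually
    rintro ⟨s, t⟩ -
    have hc : Continuous (fun z : C(unitInterval, Matrix (Fin N) (Fin N) ℂ) ×
        (unitInterval × unitInterval) =>
          (g z.2.2 + ((z.2.1 : ℝ) : ℂ) • (z.1 z.2.2 - g z.2.2)).det) := by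
      fun_prop
    apply hc.continuousAt.eventually_ne
    simpa [g] using (γ t).2.2
  obtain ⟨m, hm0, hm⟩ : ∃ m : ℕ, m ≠ 0 ∧ ∀ᶠ f in 𝓝 (bernsteinApproximation m g), good f :=
    ((eventually_ne_atTop 0).and
      ((bernsteinApproximation_uniform g).eventually hgood.eventually_nhds)).exists
  let P : ℂ → Matrix (Fin N) (Fin N) ℂ := fun z =>
    ∑ j : Fin (m + 1), ((m.choose j : ℂ) * z ^ (j : ℕ) * (1 - z) ^ (m - j)) • g (bernstein.z j)
  have hPc : Continuous P := by fun_prop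
  have hPW : ∀ (V : Submodule ℂ (Matrix (Fin N) (Fin N) ℂ)), (∀ t, g t ∈ V) → ∀ z, P z ∈ V :=
    fun V hV z => V.sum_mem fun j _ => V.smul_mem _ (hV _)
  have hPB : ∀ t : unitInterval, P ((t : ℝ) : ℂ) = bernsteinApproximation m g t := by
    intro t
    rw [bernsteinApproximation.apply]
    refine Finset.sum_congr rfl fun j _ => ?_
    rw [bernstein_apply, ← Complex.coe_smul]
    push_cast
    rfl
  let F : ℝ → C(unitInterval, Matrix (Fin N) (Fin N) ℂ) :=
    fun s => ⟨fun t => P (((t : ℝ) : ℂ) + Complex.I * s * (t : ℝ) * (1 - (t : ℝ))), by fun_prop⟩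
  have hF : Continuous F := by
    apply ContinuousMap.continuous_of_continuous_uncurry
    change Continuous (fun z : ℝ × unitInterval =>
      P (((z.2 : ℝ) : ℂ) + Complex.I * (z.1 : ℝ) * (z.2 : ℝ) * (1 - (z.2 : ℝ))))
    fun_prop
  have hF0 : F 0 = bernsteinApproximation m g := by
    ext1 t
    rw [← hPB]
    simp [F]
  have hs : ∀ᶠ s in 𝓝 (0 : ℝ), good (F s) := hF.continuousAt.eventually (by rw [hF0]; exact hm)
  obtain ⟨ε, hε, hεs⟩ := Metric.eventually_nhds_iff.1 hs
  let p : ℂ[X] := ∑ j : Fin (m + 1),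
    (Polynomial.C (m.choose j : ℂ) * X ^ (j : ℕ) * (1 - X) ^ (m - j)) *
      Polynomial.C (g (bernstein.z j) k k)
  have hp : ∀ z, p.eval z = P z k k := by
    intro z
    simp [p, P, Polynomial.eval_finsetSum, Matrix.sum_apply]
  have hP0 : P 0 = a.1 := by
    have := hPB 0
    simpa [g] using this
  have hP1 : P 1 = b.1 := by
    have := hPB 1
    simpa [g, bernsteinApproximation.apply_one hm0] using this
  obtain ⟨s, hs0, hsε, hsp⟩ := arc_avoid p (by rw [hp, hP0]; exact ha) (by rw [hp, hP1]; exact hb)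
    ε hε
  have hgs : good (F s) := hεs (by simpa [abs_of_pos hs0] using hsε)
  have hFsym : ∀ t, (F s t).IsSymm := fun t => hPW (symSub N) (fun t => (γ t).2.1) _
  have hF0' : F s 0 = a.1 := by simpa [F] using hP0
  have hF1' : F s 1 = b.1 := by simpa [F] using hP1
  let H : unitInterval × unitInterval → SY N := fun st =>
    ⟨g st.2 + ((st.1 : ℝ) : ℂ) • (F s st.2 - g st.2),
      (γ st.2).2.1.add (((hFsym st.2).sub (γ st.2).2.1).smul _), hgs st trivial⟩
  have hH : Continuous H := Continuous.subtype_mk (by fun_prop) _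
  let δ : Path a b :=
    { toFun := fun t => ⟨F s t, hFsym t, by simpa using hgs (1, t) trivial⟩
      continuous_toFun := Continuous.subtype_mk (by fun_prop) _
      source' := Subtype.ext hF0'
      target' := Subtype.ext hF1' }
  refine ⟨δ, homotopic_of γ δ H hH ?_ ?_ ?_ ?_, fun t => hPW W hW _, ?_⟩
  · intro t; apply Subtype.ext; simp [H, g]
  · intro t; apply Subtype.ext; simp [H, δ]
  · intro t; apply Subtype.ext; simp [H, g, hF0']
  · intro t; apply Subtype.ext; simp [H, g, hF1']
  · intro t
    have := hsp t
    rw [hp] at this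
    exact this
/-- matrices whose first `k` rows and columns are diagonal -/
def diagSub (N : ℕ) (k : ℕ) : Submodule ℂ (Matrix (Fin N) (Fin N) ℂ) where
  carrier := {A | ∀ i j : Fin N, i ≠ j → (i.1 < k ∨ j.1 < k) → A i j = 0}
  add_mem' := fun {a b} ha hb i j h h' => by
    simp [ha i j h h', hb i j h h']
  zero_mem' := fun i j _ _ => rfl
  smul_mem' := fun c A h i j h1 h2 => by simp [h i j h1 h2]

/-- elimination vector -/
noncomputable def elimVec {N : ℕ} (k : Fin N) (A : Matrix (Fin N) (Fin N) ℂ) : Fin N → ℂ :=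
  fun i => if i = k then 0 else A i k / A k k

/-- elimination matrix -/
noncomputable def elimMat {N : ℕ} (k : Fin N) (s : ℂ) (A : Matrix (Fin N) (Fin N) ℂ) :
    Matrix (Fin N) (Fin N) ℂ :=
  1 + Matrix.replicateCol Unit (fun i => -s * elimVec k A i) *
    Matrix.replicateRow Unit (Pi.single k (1 : ℂ))

lemma det_elimMat {N : ℕ} (k : Fin N) (s : ℂ) (A : Matrix (Fin N) (Fin N) ℂ) :
    (elimMat k s A).det = 1 := by
  rw [elimMat, Matrix.det_one_add_replicateCol_mul_replicateRow]
  simp [elimVec]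

lemma elimMat_apply {N : ℕ} (k : Fin N) (s : ℂ) (A : Matrix (Fin N) (Fin N) ℂ) (i j : Fin N) :
    elimMat k s A i j = (1 : Matrix (Fin N) (Fin N) ℂ) i j +
      -s * elimVec k A i * (Pi.single k 1 : Fin N → ℂ) j := by
  simp [elimMat, Matrix.mul_apply]

lemma elimMat_mul {N : ℕ} (k : Fin N) (s : ℂ) (A B : Matrix (Fin N) (Fin N) ℂ) (i j : Fin N) :
    (elimMat k s A * B) i j = B i j - s * elimVec k A i * B k j := by
  simp only [Matrix.mul_apply, elimMat_apply, add_mul, Finset.sum_add_distrib]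
  simp [Matrix.one_apply, Pi.single_apply]
  ring

lemma mul_elimMat {N : ℕ} (k : Fin N) (s : ℂ) (A B : Matrix (Fin N) (Fin N) ℂ) (i j : Fin N) :
    (B * (elimMat k s A)ᵀ) i j = B i j - s * elimVec k A j * B i k := by
  have := elimMat_mul k s A Bᵀ j i
  rw [← Matrix.transpose_apply (B * _), Matrix.transpose_mul, Matrix.transpose_transpose, this]
  simp

lemma continuous_elimMat {N : ℕ} (k : Fin N) {T : Type*} [TopologicalSpace T] (f : T → ℂ)
    (A : T → Matrix (Fin N) (Fin N) ℂ) (hf : Continuous f) (hA : Continuous A)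
    (h : ∀ t, A t k k ≠ 0) : Continuous (fun t => elimMat k (f t) (A t)) := by
  refine continuous_matrix fun i j => ?_
  simp only [elimMat_apply]
  have hv : Continuous (fun t => elimVec k (A t) i) := by
    unfold elimVec
    split_ifs
    · exact continuous_const
    · exact (hA.matrix_elem i k).div (hA.matrix_elem k k) h
  fun_prop

lemma elim_diag {N : ℕ} (k : Fin N) (s : ℂ) (A : Matrix (Fin N) (Fin N) ℂ)
    (h : ∀ i j, i ≠ j → A i j = 0) : elimMat k s A = 1 := by
  ext i j
  rw [elimMat_apply]
  have : elimVec k A i = 0 := by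
    unfold elimVec
    split_ifs with hi
    · rfl
    · rw [h i k hi]; simp
  simp [this]

lemma elim_path {N : ℕ} (k : Fin N)
    {a b : SY N} (ha : ∀ i j, i ≠ j → a.1 i j = 0) (hb : ∀ i j, i ≠ j → b.1 i j = 0)
    (γ : Path a b) (hW : ∀ t, (γ t).1 ∈ diagSub N k) (hk : ∀ t, (γ t).1 k k ≠ 0) :
    ∃ δ : Path a b, γ.Homotopic δ ∧ (∀ t, (δ t).1 ∈ diagSub N (k + 1)) := by
  let H : unitInterval × unitInterval → SY N := fun st =>
    ⟨elimMat k (st.1 : ℝ) (γ st.2).1 * (γ st.2).1 * (elimMat k (st.1 : ℝ) (γ st.2).1)ᵀ, by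
      have := (γ st.2).2.1
      unfold Matrix.IsSymm at *
      rw [Matrix.transpose_mul, Matrix.transpose_mul, Matrix.transpose_transpose, this, mul_assoc],
      by simpa [Matrix.det_mul, det_elimMat] using (γ st.2).2.2⟩
  have hc : Continuous fun st : unitInterval × unitInterval => (γ st.2).1 :=
    (sy_path_ext_cont γ).comp continuous_snd
  have hH : Continuous H := by
    refine Continuous.subtype_mk ?_ _
    have := continuous_elimMat k (fun st : unitInterval × unitInterval => ((st.1 : ℝ) : ℂ))
      (fun st => (γ st.2).1) (by fun_prop) hc (fun _ => hk _)
    exact (this.matrix_mul hc).matrix_mul this.matrix_transpose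
  have hHa : ∀ s, H (s, 0) = a := fun s => by
    apply Subtype.ext
    simp only [H, Path.source, elim_diag k _ a.1 ha]
    simp
  have hHb : ∀ s, H (s, 1) = b := fun s => by
    apply Subtype.ext
    simp only [H, Path.target, elim_diag k _ b.1 hb]
    simp
  let δ : Path a b :=
    { toFun := fun t => H (1, t)
      continuous_toFun := hH.comp (by fun_prop)
      source' := hHa 1
      target' := hHb 1 }
  refine ⟨δ, homotopic_of γ δ H hH ?_ (fun _ => rfl) hHa hHb, ?_⟩
  · intro t
    have : elimMat k 0 (γ t).1 = 1 := by ext i j; simp [elimMat_apply]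
    apply Subtype.ext
    simp [H, this]
  · intro t i j hij hlt
    change (elimMat k ((1 : ℝ) : ℂ) (γ t).1 * (γ t).1 * (elimMat k ((1 : ℝ) : ℂ) (γ t).1)ᵀ) i j = 0
    have hs : ∀ i j, (γ t).1 i j = (γ t).1 j i := fun i j => ((γ t).2.1.apply i j).symm
    have hkk := hk t
    have hWt := hW t
    have hv : ∀ i : Fin N, i.1 < k → elimVec k (γ t).1 i = 0 := by
      intro i hi
      have hik : i ≠ k := fun h => by rw [h] at hi; exact lt_irrefl _ hi
      simp only [elimVec, if_neg hik]
      rw [hWt i k hik (Or.inl hi)]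
      simp
    have hvk : elimVec k (γ t).1 k = 0 := by simp [elimVec]
    have hv2 : ∀ i : Fin N, i ≠ k → elimVec k (γ t).1 i * (γ t).1 k k = (γ t).1 i k := by
      intro i hi
      simp only [elimVec, if_neg hi]
      field_simp
    rw [mul_elimMat, elimMat_mul, elimMat_mul]
    by_cases hik : i = k
    · subst hik
      rw [hvk, ← hs j i, ← hv2 j hij.symm]
      simp
    by_cases hjk : j = k
    · subst hjk
      rw [hvk, ← hv2 i hij]
      simp
    have hlt' : i.1 < k.1 ∨ j.1 < k.1 := by
      have := Fin.val_ne_of_ne hik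
      have := Fin.val_ne_of_ne hjk
      omega
    rw [hWt i j hij hlt']
    rcases hlt' with h | h
    · rw [hv i h, hWt i k hik (Or.inl h)]; simp
    · rw [hv j h, hWt k j (Ne.symm hjk) (Or.inr h)]; simp

lemma diag_path {N : ℕ}
    {a b : SY N} (ha : ∀ i j, i ≠ j → a.1 i j = 0) (hb : ∀ i j, i ≠ j → b.1 i j = 0)
    (γ : Path a b) (k : ℕ) (hk : k ≤ N) :
    ∃ δ : Path a b, γ.Homotopic δ ∧ (∀ t, (δ t).1 ∈ diagSub N k) := by
  have hdiag : ∀ (c : SY N), (∀ i j, i ≠ j → c.1 i j = 0) → ∀ k, c.1 k k ≠ 0 := by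
    intro c hc k h0
    apply c.2.2
    apply Matrix.det_eq_zero_of_row_eq_zero k
    intro j
    by_cases h : k = j
    · rw [← h, h0]
    · exact hc k j h
  induction k with
  | zero => exact ⟨γ, Path.Homotopic.refl _, fun t i j _ h => by simp at h⟩
  | succ k ih =>
    obtain ⟨δ, h1, h2⟩ := ih (by omega)
    obtain ⟨δ', h1', h2', h3'⟩ := generic_path (diagSub N k) ⟨k, hk⟩ (hdiag a ha _) (hdiag b hb _)
      δ h2
    obtain ⟨δfin, hfin, hdg⟩ := elim_path ⟨k, hk⟩ ha hb δ' h2' h3'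
    exact ⟨δfin, (h1.trans h1').trans hfin, hdg⟩

/-- the space of nonsingular quadrics -/
abbrev QX (n : ℕ) : Type := MatQuot (n + 1) (fun A => A.IsSymm ∧ A.det ≠ 0)

/-- the projection -/
def qq (n : ℕ) (A : SY (n + 1)) : QX n := Quotient.mk _ A

lemma continuous_qq (n : ℕ) : Continuous (qq n) := continuous_quotient_mk'

lemma qq_eq {n : ℕ} {A B : SY (n + 1)} : qq n A = qq n B ↔ ∃ c : ℂˣ, B.1 = (c : ℂ) • A.1 :=
  Quotient.eq

/-- symmetric matrices of determinant one -/
abbrev SE (N : ℕ) : Type :=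
  {A : Matrix (Fin N) (Fin N) ℂ // A.IsSymm ∧ A.det = 1}

/-- inclusion -/
def incl {N : ℕ} (A : SE N) : SY N := ⟨A.1, A.2.1, by rw [A.2.2]; exact one_ne_zero⟩

lemma continuous_incl {N : ℕ} : Continuous (incl (N := N)) :=
  Continuous.subtype_mk continuous_subtype_val _

instance actSE (n : ℕ) : MulAction (rootsOfUnity (n + 1) ℂ) (SE (n + 1)) where
  smul g A := ⟨((g : ℂˣ) : ℂ) • A.1, A.2.1.smul _, by
    have h := g.2
    rw [mem_rootsOfUnity] at h
    have h' : ((g : ℂˣ) : ℂ) ^ (n + 1) = 1 := by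
      rw [← Units.val_pow_eq_pow_val, h, Units.val_one]
    rw [Matrix.det_smul, A.2.2, Fintype.card_fin, h', mul_one]⟩
  one_smul A := Subtype.ext (one_smul _ A.1)
  mul_smul g h A := Subtype.ext (mul_smul ((g : ℂˣ) : ℂ) ((h : ℂˣ) : ℂ) A.1)

lemma actSE_val {n : ℕ} (g : rootsOfUnity (n + 1) ℂ) (A : SE (n + 1)) :
    (g • A).1 = ((g : ℂˣ) : ℂ) • A.1 := rfl

instance actSE_cont (n : ℕ) : ContinuousConstSMul (rootsOfUnity (n + 1) ℂ) (SE (n + 1)) where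
  continuous_const_smul g := by
    have h : Continuous fun A : SE (n + 1) => ((g : ℂˣ) : ℂ) • A.1 := by fun_prop
    exact h.subtype_mk _

lemma smul_inj_of_det {n : ℕ} {A : Matrix (Fin (n + 1)) (Fin (n + 1)) ℂ} (hA : A.det ≠ 0) {c d : ℂ}
    (h : c • A = d • A) : c = d := by
  have h0 : A ≠ 0 := by
    rintro rfl
    simp at hA
  exact smul_left_injective ℂ h0 h

instance actSE_cancel (n : ℕ) : IsCancelSMul (rootsOfUnity (n + 1) ℂ) (SE (n + 1)) where
  right_cancel' g h A hgh := by
    have := congrArg Subtype.val hgh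
    rw [actSE_val, actSE_val] at this
    have h2 := smul_inj_of_det (incl A).2.2 this
    exact Subtype.ext (Units.ext h2)

lemma isClosed_SE (N : ℕ) :
    IsClosed {A : Matrix (Fin N) (Fin N) ℂ | A.IsSymm ∧ A.det = 1} := by
  apply IsClosed.inter
  · exact isClosed_eq (by fun_prop) (by fun_prop)
  · exact isClosed_eq (by fun_prop) (by fun_prop)

instance locCompMat (N : ℕ) : LocallyCompactSpace (Matrix (Fin N) (Fin N) ℂ) :=
  inferInstanceAs (LocallyCompactSpace (Fin N → Fin N → ℂ))

instance locCompSE (N : ℕ) : LocallyCompactSpace (SE N) :=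
  (isClosed_SE N).isClosedEmbedding_subtypeVal.locallyCompactSpace

/-- the covering map -/
def cv (n : ℕ) (A : SE (n + 1)) : QX n := qq n (incl A)

lemma continuous_cv (n : ℕ) : Continuous (cv n) := (continuous_qq n).comp continuous_incl

lemma cv_eq {n : ℕ} {A B : SE (n + 1)} :
    cv n A = cv n B ↔ A ∈ MulAction.orbit (rootsOfUnity (n + 1) ℂ) B := by
  rw [eq_comm, cv, cv, qq_eq]
  constructor
  · rintro ⟨c, hc⟩
    change A.1 = (c : ℂ) • B.1 at hc
    have h := congrArg Matrix.det hc
    rw [Matrix.det_smul, A.2.2, B.2.2, Fintype.card_fin, mul_one] at h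
    refine ⟨⟨c, ?_⟩, Subtype.ext hc.symm⟩
    rw [mem_rootsOfUnity]
    exact Units.ext (by simpa using h.symm)
  · rintro ⟨g, rfl⟩
    exact ⟨g, rfl⟩

/-- normalisation of the determinant -/
noncomputable def nrm (n : ℕ) (A : SY (n + 1)) : SE (n + 1) :=
  ⟨(A.1.det ^ (-((n + 1 : ℕ) : ℂ)⁻¹)) • A.1, A.2.1.smul _, by
    rw [Matrix.det_smul, Fintype.card_fin, Complex.cpow_neg, inv_pow,
      Complex.cpow_nat_inv_pow _ (Nat.succ_ne_zero n), inv_mul_cancel₀ A.2.2]⟩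

lemma cv_nrm (n : ℕ) (A : SY (n + 1)) : cv n (nrm n A) = qq n A := by
  symm
  rw [cv, qq_eq]
  exact ⟨Units.mk0 (A.1.det ^ (-((n + 1 : ℕ) : ℂ)⁻¹)) (by
    rw [Complex.cpow_def_of_ne_zero A.2.2]; exact Complex.exp_ne_zero _), rfl⟩

/-- scaling -/
def scl {n : ℕ} (c : ℂˣ) (A : SY (n + 1)) : SY (n + 1) :=
  ⟨(c : ℂ) • A.1, A.2.1.smul _, by
    rw [Matrix.det_smul]; exact mul_ne_zero (pow_ne_zero _ c.ne_zero) A.2.2⟩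

lemma qq_scl {n : ℕ} (c : ℂˣ) (A : SY (n + 1)) : qq n (scl c A) = qq n A := by
  symm; rw [qq_eq]; exact ⟨c, rfl⟩

lemma continuous_scl {n : ℕ} (c : ℂˣ) : Continuous (scl (n := n) c) := by
  have h : Continuous fun A : SY (n + 1) => (c : ℂ) • A.1 := by fun_prop
  exact h.subtype_mk _

lemma isOpenMap_cv (n : ℕ) : IsOpenMap (cv n) := by
  intro V hV
  have : IsOpen (qq n ⁻¹' (cv n '' V)) := by
    rw [isOpen_iff_mem_nhds]
    rintro A ⟨B, hB, hBA⟩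
    obtain ⟨c, hc⟩ := qq_eq.1 hBA.symm
    change B.1 = (c : ℂ) • A.1 at hc
    have hdet : (scl c A).1.det = 1 := by
      change ((c : ℂ) • A.1).det = 1
      rw [← hc, B.2.2]
    have hcont : ContinuousAt (fun A' => nrm n (scl c A')) A := by
      refine Topology.IsInducing.subtypeVal.continuousAt_iff.2 ?_
      have h1 : ContinuousAt (fun A' => (scl c A').1) A :=
        (continuous_subtype_val.comp (continuous_scl c)).continuousAt
      have h2 : ContinuousAt (fun A' => (scl c A').1.det) A :=
        ((continuous_subtype_val.comp (continuous_scl c)).matrix_det).continuousAt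
      refine ContinuousAt.smul (h2.cpow continuousAt_const ?_) h1
      rw [hdet]
      exact Complex.one_mem_slitPlane
    have hval : nrm n (scl c A) = B := by
      apply Subtype.ext
      change ((scl c A).1.det ^ _) • ((c : ℂ) • A.1) = B.1
      rw [hdet, Complex.one_cpow, one_smul, hc]
    have := hcont.preimage_mem_nhds (t := V) (by simp only [hval]; exact hV.mem_nhds hB)
    refine Filter.mem_of_superset this fun A' hA' => ?_
    exact ⟨_, hA', by rw [cv_nrm, qq_scl]⟩
  exact this

lemma surjective_cv (n : ℕ) : Function.Surjective (cv n) := by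
  intro x
  induction x using Quotient.inductionOn with
  | h A => exact ⟨nrm n A, cv_nrm n A⟩

lemma isCoveringMap_cv (n : ℕ) : IsCoveringMap (cv n) :=
  (((isOpenMap_cv n).isQuotientMap (continuous_cv n)
    (surjective_cv n)).isQuotientCoveringMap_of_properlyDiscontinuousSMul
      (G := rootsOfUnity (n + 1) ℂ) cv_eq).isCoveringMap
/-- the torus of diagonal matrices -/
noncomputable def expd {N : ℕ} (w : Fin N → ℂ) : SY N :=
  ⟨Matrix.diagonal fun j => Complex.exp (w j), Matrix.isSymm_diagonal _, by
    rw [Matrix.det_diagonal]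
    exact Finset.prod_ne_zero_iff.2 fun j _ => Complex.exp_ne_zero _⟩

lemma continuous_expd {N : ℕ} : Continuous (expd (N := N)) := by
  have h : Continuous fun w : Fin N → ℂ => Matrix.diagonal fun j => Complex.exp (w j) := by
    fun_prop
  exact h.subtype_mk _

/-- the torus in the quotient -/
noncomputable def fx (n : ℕ) (w : Fin (n + 1) → ℂ) : QX n := qq n (expd w)

lemma continuous_fx (n : ℕ) : Continuous (fx n) := (continuous_qq n).comp continuous_expd

lemma fx_add_const (n : ℕ) (w : Fin (n + 1) → ℂ) (c : ℂ) : fx n (fun j => w j + c) = fx n w := by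
  symm
  unfold fx
  rw [qq_eq]
  refine ⟨Units.mk0 (Complex.exp c) (Complex.exp_ne_zero _), ?_⟩
  ext i j
  by_cases h : i = j
  · subst h
    simp [expd, Complex.exp_add, mul_comm]
  · simp [expd, h]

/-- integer vectors times 2πi -/
noncomputable def vz {n : ℕ} (m : Fin (n + 1) → ℤ) : Fin (n + 1) → ℂ :=
  fun j => m j * (2 * Real.pi * Complex.I)

lemma vz_add {n : ℕ} (m m' : Fin (n + 1) → ℤ) : vz (m + m') = vz m + vz m' := by
  ext j; simp [vz]; ring

lemma fx_add_vz {n : ℕ} (w : Fin (n + 1) → ℂ) (m : Fin (n + 1) → ℤ) : fx n (w + vz m) = fx n w := by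
  unfold fx
  congr 1
  apply Subtype.ext
  simp only [expd]
  congr 1
  ext j
  simp only [Pi.add_apply, vz]
  exact Complex.exp_periodic.int_mul (m j) (w j)

/-- base point -/
noncomputable def x0 (n : ℕ) : QX n := fx n 0

lemma x0_eq (n : ℕ) : x0 n = fx n 0 := rfl

lemma fx_vz {n : ℕ} (m : Fin (n + 1) → ℤ) : fx n (vz m) = x0 n := by
  have := fx_add_vz 0 m
  rwa [zero_add] at this

/-- standard loops -/
noncomputable def stdLoop {n : ℕ} (m : Fin (n + 1) → ℤ) : Path (x0 n) (x0 n) where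
  toFun t := fx n (((t : ℝ) : ℂ) • vz m)
  continuous_toFun := (continuous_fx n).comp (by fun_prop)
  source' := by simp [x0]
  target' := by simp [fx_vz]

lemma stdLoop_apply {n : ℕ} (m : Fin (n + 1) → ℤ) (t : unitInterval) :
    stdLoop m t = fx n (((t : ℝ) : ℂ) • vz m) := rfl

/-- straight path -/
noncomputable def stp {n : ℕ} (u v : Fin (n + 1) → ℂ) : Path u (u + v) where
  toFun t := u + ((t : ℝ) : ℂ) • v
  continuous_toFun := by fun_prop
  source' := by simp
  target' := by simp

lemma stdLoop_add {n : ℕ} (m m' : Fin (n + 1) → ℤ) :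
    (stdLoop (m + m')).Homotopic ((stdLoop m).trans (stdLoop m')) := by
  have e : (0 : Fin (n + 1) → ℂ) + vz (m + m') = 0 + vz m + vz m' := by rw [vz_add]; ring
  have h : Path.Homotopic ((stp 0 (vz (m + m'))).cast rfl e.symm)
    ((stp 0 (vz m)).trans (stp (0 + vz m) (vz m'))) := SimplyConnectedSpace.paths_homotopic _ _
  have e2 : x0 n = fx n (0 + vz m + vz m') := by
    rw [zero_add, fx_add_vz, fx_vz]
  have h2 := (h.map ⟨fx n, continuous_fx n⟩).pathCast (x₂ := x0 n) (x₃ := x0 n) (x0_eq n) e2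
  have a1 : stdLoop (m + m') = (((stp 0 (vz (m + m'))).cast rfl e.symm).map
      (continuous_fx n)).cast (x0_eq n) e2 := by
    ext t
    change fx n (((t : ℝ) : ℂ) • vz (m + m')) = fx n (0 + ((t : ℝ) : ℂ) • vz (m + m'))
    rw [zero_add]
  have a2 : (stdLoop m).trans (stdLoop m') =
      (((stp 0 (vz m)).trans (stp (0 + vz m) (vz m'))).map (continuous_fx n)).cast (x0_eq n) e2 := by
    ext t
    change _ = fx n (((stp 0 (vz m)).trans (stp (0 + vz m) (vz m'))) t)
    rw [Path.trans_apply, Path.trans_apply]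
    split_ifs
    · rw [stdLoop_apply]
      change _ = fx n (0 + _)
      rw [zero_add]
    · rw [stdLoop_apply]
      change _ = fx n (0 + vz m + _)
      rw [zero_add, add_comm (vz m) _, fx_add_vz]
  rw [a1, a2]
  exact h2

/-- classes of loops -/
noncomputable def cl {n : ℕ} (γ : Path (x0 n) (x0 n)) : FundamentalGroup (QX n) (x0 n) :=
  FundamentalGroup.fromPath (Path.Homotopic.Quotient.mk γ)

lemma cl_eq {n : ℕ} {γ γ' : Path (x0 n) (x0 n)} : cl γ = cl γ' ↔ γ.Homotopic γ' :=
  Path.Homotopic.Quotient.eq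

lemma cl_surj {n : ℕ} (g : FundamentalGroup (QX n) (x0 n)) : ∃ γ, cl γ = g :=
  Path.Homotopic.Quotient.mk_surjective g

lemma cl_refl {n : ℕ} : cl (Path.refl (x0 n)) = 1 := rfl

lemma cl_stdLoop_add {n : ℕ} (m m' : Fin (n + 1) → ℤ) : cl (stdLoop (m + m')) = cl (stdLoop m') * cl (stdLoop m) :=
  cl_eq.2 (stdLoop_add m m')

lemma cl_stdLoop_zero {n : ℕ} : cl (stdLoop (0 : Fin (n + 1) → ℤ)) = 1 := by
  have := cl_stdLoop_add (0 : Fin (n + 1) → ℤ) 0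
  rw [add_zero] at this
  exact left_eq_mul.1 this

/-- generator -/
noncomputable def gen (n : ℕ) : FundamentalGroup (QX n) (x0 n) := cl (stdLoop (Pi.single 0 1))

/-- rotating vector -/
noncomputable def rv {n : ℕ} (j : Fin (n + 1)) (s : ℝ) : Fin (n + 1) → ℂ :=
  fun i => (Real.cos (s * (Real.pi / 2)) : ℂ) * (Pi.single 0 (1 : ℂ) : Fin (n + 1) → ℂ) i +
    (Real.sin (s * (Real.pi / 2)) : ℂ) * (Pi.single j (1 : ℂ) : Fin (n + 1) → ℂ) i

lemma rv_dot {n : ℕ} (j : Fin (n + 1)) (hj : j ≠ 0) (s : ℝ) : rv j s ⬝ᵥ rv j s = 1 := by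
  have h : rv j s ⬝ᵥ rv j s = (Real.cos (s * (Real.pi / 2)) : ℂ) ^ 2 +
      (Real.sin (s * (Real.pi / 2)) : ℂ) ^ 2 := by
    have e : rv j s = (Real.cos (s * (Real.pi / 2)) : ℂ) • Pi.single 0 (1 : ℂ) +
      (Real.sin (s * (Real.pi / 2)) : ℂ) • Pi.single j (1 : ℂ) := by
      ext i; simp [rv]
    rw [e]
    simp [dotProduct_add, hj, hj.symm, -Complex.ofReal_sin, -Complex.ofReal_cos]
    ring
  rw [h]
  exact_mod_cast Real.cos_sq_add_sin_sq _

/-- rank one perturbation of the identity -/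
noncomputable def rk {n : ℕ} (v : Fin (n + 1) → ℂ) (c : ℂ) :
    Matrix (Fin (n + 1)) (Fin (n + 1)) ℂ :=
  1 + Matrix.replicateCol Unit (fun i => c * v i) * Matrix.replicateRow Unit v

lemma rk_apply {n : ℕ} (v : Fin (n + 1) → ℂ) (c : ℂ) (i j : Fin (n + 1)) :
    rk v c i j = (1 : Matrix (Fin (n + 1)) (Fin (n + 1)) ℂ) i j + c * v i * v j := by
  simp [rk, Matrix.mul_apply]

lemma rk_det {n : ℕ} (v : Fin (n + 1) → ℂ) (c : ℂ) (hv : v ⬝ᵥ v = 1) : (rk v c).det = 1 + c := by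
  rw [rk, Matrix.det_one_add_replicateCol_mul_replicateRow]
  have : v ⬝ᵥ (fun i => c * v i) = c * (v ⬝ᵥ v) := by
    simp only [dotProduct, Finset.mul_sum]
    exact Finset.sum_congr rfl fun i _ => by ring
  rw [this, hv, mul_one]

lemma rk_symm {n : ℕ} (v : Fin (n + 1) → ℂ) (c : ℂ) : (rk v c).IsSymm := by
  ext i j
  rw [Matrix.transpose_apply, rk_apply, rk_apply, ← Matrix.transpose_apply 1, Matrix.transpose_one]
  ring

lemma rk_single {n : ℕ} (j : Fin (n + 1)) (t : ℂ) :
    rk (Pi.single j 1) (Complex.exp (t * (2 * Real.pi * Complex.I)) - 1) =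
      (expd (t • vz (Pi.single j 1))).1 := by
  ext a b
  rw [rk_apply]
  by_cases h : a = b
  · subst h
    by_cases h' : a = j
    · subst h'; simp [expd, vz]
    · simp [expd, vz, h']
  · by_cases h' : a = j
    · subst h'; simp [expd, h, Ne.symm h]
    · simp [expd, h, h']

lemma cl_single {n : ℕ} (j : Fin (n + 1)) : cl (stdLoop (Pi.single j 1)) = gen n := by
  by_cases hj : j = 0
  · rw [hj]; rfl
  symm
  apply cl_eq.2
  let H : unitInterval × unitInterval → SY (n + 1) := fun st =>
    ⟨rk (rv j st.1) (Complex.exp ((st.2 : ℝ) * (2 * Real.pi * Complex.I)) - 1), rk_symm _ _, by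
      rw [rk_det _ _ (rv_dot j hj _)]; simp⟩
  have hH : Continuous H := by
    have : Continuous fun st : unitInterval × unitInterval =>
        rk (rv j st.1) (Complex.exp ((st.2 : ℝ) * (2 * Real.pi * Complex.I)) - 1) := by
      refine continuous_matrix fun a b => ?_
      simp only [rk_apply, rv]
      fun_prop
    exact this.subtype_mk _
  have h0 : rv j 0 = Pi.single 0 1 := by ext i; simp [rv]
  have h1 : rv j 1 = Pi.single j 1 := by ext i; simp [rv]
  have hx : qq n (⟨1, Matrix.isSymm_one, by simp⟩ : SY (n + 1)) = x0 n := by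
    unfold x0 fx
    congr 1
    apply Subtype.ext
    simp [expd]
  have hrk0 : ∀ v : Fin (n + 1) → ℂ, rk v 0 = 1 := by
    intro v; ext a b; simp [rk_apply]
  refine homotopic_of _ _ (fun st => qq n (H st)) ((continuous_qq n).comp hH) ?_ ?_ ?_ ?_
  · intro t
    rw [stdLoop_apply, fx]
    congr 1
    apply Subtype.ext
    change rk (rv j (0 : ℝ)) _ = _
    rw [h0, rk_single]
  · intro t
    rw [stdLoop_apply, fx]
    congr 1
    apply Subtype.ext
    change rk (rv j (1 : ℝ)) _ = _
    rw [h1, rk_single]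
  · intro s
    rw [← hx]
    congr 1
    apply Subtype.ext
    simp [H, hrk0]
  · intro s
    rw [← hx]
    congr 1
    apply Subtype.ext
    simp [H, hrk0]

lemma cl_stdLoop {n : ℕ} (m : Fin (n + 1) → ℤ) : cl (stdLoop m) = gen n ^ (∑ j, m j) := by
  let K : AddSubgroup (Fin (n + 1) → ℤ) :=
    { carrier := {m | cl (stdLoop m) = gen n ^ (∑ j, m j)}
      add_mem' := by
        intro a b ha hb
        simp only [Set.mem_ofPred_eq] at *
        rw [cl_stdLoop_add, ha, hb, ← _root_.zpow_add]
        congr 1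
        simp only [Pi.add_apply, Finset.sum_add_distrib]
        exact add_comm _ _
      zero_mem' := by simp [cl_stdLoop_zero]
      neg_mem' := by
        intro a ha
        simp only [Set.mem_ofPred_eq] at *
        have := cl_stdLoop_add a (-a)
        rw [add_neg_cancel, cl_stdLoop_zero, ha] at this
        rw [eq_inv_of_mul_eq_one_left this.symm]
        simp }
  have hs : ∀ j, (Pi.single j 1 : Fin (n + 1) → ℤ) ∈ K := by
    intro j
    change cl _ = _
    rw [cl_single]
    simp
  have : m ∈ K := by
    have e : m = ∑ j, m j • (Pi.single j 1 : Fin (n + 1) → ℤ) := by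
      ext i; simp [Finset.sum_apply, Pi.single_apply]
    rw [e]
    exact K.sum_mem fun j _ => K.zsmul_mem (hs j) _
  exact this

lemma gen_pow (n : ℕ) : gen n ^ (n + 1) = 1 := by
  have h := cl_stdLoop (n := n) (fun _ => 1)
  have h2 : stdLoop (n := n) (fun _ => 1) = Path.refl _ := by
    ext t
    rw [stdLoop_apply, Path.refl_apply, x0]
    have := fx_add_const n 0 ((t : ℝ) * (2 * Real.pi * Complex.I))
    rw [← this]
    congr 1
    ext j
    simp [vz]
  rw [h2, cl_refl] at h
  rw [h]
  simp [← zpow_natCast]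
lemma exists_log {n : ℕ} {a b : SY (n + 1)} (δ : Path a b) (h : ∀ t, (δ t).1 ∈ diagSub (n + 1) (n + 1))
    (ha : a.1 = 1) : ∃ w : unitInterval → Fin (n + 1) → ℂ, Continuous w ∧ w 0 = 0 ∧
      ∀ t, δ t = expd (w t) := by
  have hd : ∀ t i j, i ≠ j → (δ t).1 i j = 0 := fun t i j hij => h t i j hij (Or.inl i.2)
  have hne : ∀ t k, (δ t).1 k k ≠ 0 := by
    intro t k h0
    apply (δ t).2.2
    apply Matrix.det_eq_zero_of_row_eq_zero k
    intro j
    by_cases hk : k = j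
    · rw [← hk, h0]
    · exact hd t k j hk
  have hl : ∀ k, ∃ W : C(unitInterval, ℂ),
      (fun z : ℂ ↦ (⟨_, z.exp_ne_zero⟩ : {z : ℂ // z ≠ 0})) ∘ W =
        (fun t => ⟨(δ t).1 k k, hne t k⟩) ∧ W 0 = 0 := by
    intro k
    have hc : Continuous fun t => (⟨(δ t).1 k k, hne t k⟩ : {z : ℂ // z ≠ 0}) :=
      ((sy_path_ext_cont δ).matrix_elem k k).subtype_mk _
    refine Complex.isCoveringMap_exp.exists_path_lifts ⟨_, hc⟩ 0 ?_
    apply Subtype.ext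
    simp [ha]
  choose W hW hW0 using hl
  refine ⟨fun t k => W k t, by fun_prop, by ext k; simp [hW0], fun t => ?_⟩
  apply Subtype.ext
  ext i j
  by_cases hij : i = j
  · subst hij
    have := congrArg Subtype.val (congrFun (hW i) t)
    simp only [Function.comp] at this
    simp [expd, this]
  · rw [hd t i j hij]
    simp [expd, hij]

/-- the identity, in the cover -/
def e1 (n : ℕ) : SE (n + 1) := ⟨1, Matrix.isSymm_one, Matrix.det_one⟩

lemma cv_e1 (n : ℕ) : cv n (e1 n) = x0 n := by
  unfold cv x0 fx
  congr 1
  apply Subtype.ext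
  simp [expd, incl, e1]

lemma all_gen {n : ℕ} (g : FundamentalGroup (QX n) (x0 n)) : ∃ k : ℤ, gen n ^ k = g := by
  obtain ⟨γ, rfl⟩ := cl_surj g
  obtain ⟨Γ, hΓ, hΓ0⟩ := (isCoveringMap_cv n).exists_path_lifts γ.toContinuousMap (e1 n)
    (by rw [cv_e1]; exact γ.source)
  have hΓt : ∀ t, cv n (Γ t) = γ t := fun t => congrFun hΓ t
  have h1 : cv n (Γ 1) = cv n (e1 n) := by rw [hΓt, γ.target, cv_e1]
  obtain ⟨c, hc⟩ := cv_eq.1 h1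
  have hc' : (Γ 1).1 = ((c : ℂˣ) : ℂ) • 1 := congrArg Subtype.val hc.symm
  let γY : Path (incl (e1 n)) (incl (Γ 1)) :=
    { toFun := fun t => incl (Γ t)
      continuous_toFun := continuous_incl.comp Γ.continuous
      source' := by rw [hΓ0]
      target' := rfl }
  obtain ⟨δ, hδ, hdiag⟩ := diag_path (N := n + 1)
    (fun i j hij => by simp [incl, e1, hij])
    (fun i j hij => by simp [incl, hc', hij]) γY (n + 1) le_rfl
  obtain ⟨w, hw, hw0, hwδ⟩ := exists_log δ hdiag rfl
  -- endpoint
  have hw1 : ∀ j, Complex.exp (w 1 j) = ((c : ℂˣ) : ℂ) := by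
    intro j
    have h2 := congrArg Subtype.val (hwδ 1)
    rw [δ.target] at h2
    have h3 := congrFun (congrFun h2 j) j
    simp [incl, expd, hc'] at h3
    exact h3.symm
  have hm : ∀ j, ∃ m : ℤ, w 1 j = w 1 0 + m * (2 * Real.pi * Complex.I) := fun j =>
    Complex.exp_eq_exp_iff_exists_int.1 (by rw [hw1, hw1])
  choose m hm using hm
  refine ⟨∑ j, m j, ?_⟩
  rw [← cl_stdLoop]
  symm
  apply cl_eq.2
  have hex : x0 n = qq n (incl (e1 n)) := (cv_e1 n).symm
  have hex1 : x0 n = qq n (incl (Γ 1)) := by rw [← cv_e1, ← h1]; rfl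
  have H1 := (hδ.map ⟨qq n, continuous_qq n⟩).pathCast (x₂ := x0 n) (x₃ := x0 n) hex hex1
  have e1' : γ = (γY.map (continuous_qq n)).cast hex hex1 := by
    ext t
    exact (hΓt t).symm
  let wp : Path (0 : Fin (n + 1) → ℂ) (w 1) :=
    { toFun := w
      continuous_toFun := hw
      source' := hw0
      target' := rfl }
  have H2 : wp.Homotopic ((stp 0 (w 1)).cast rfl (zero_add _).symm) :=
    SimplyConnectedSpace.paths_homotopic _ _
  have hfx1 : x0 n = fx n (w 1) := by
    unfold fx
    rw [← hwδ 1, δ.target]; exact hex1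
  have H3 := (H2.map ⟨fx n, continuous_fx n⟩).pathCast (x₂ := x0 n) (x₃ := x0 n) (x0_eq n) hfx1
  have e2 : (δ.map (continuous_qq n)).cast hex hex1 =
      (wp.map (continuous_fx n)).cast (x0_eq n) hfx1 := by
    ext t
    change qq n (δ t) = qq n (expd (w t))
    rw [hwδ]
  have e3 : (((stp 0 (w 1)).cast rfl (zero_add _).symm).map (continuous_fx n)).cast (x0_eq n) hfx1 =
      stdLoop m := by
    ext t
    change fx n (0 + ((t : ℝ) : ℂ) • w 1) = fx n (((t : ℝ) : ℂ) • vz m)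
    rw [← fx_add_const n (((t : ℝ) : ℂ) • vz m) (((t : ℝ) : ℂ) * w 1 0)]
    congr 1
    ext j
    simp [vz, hm j]
    ring
  rw [e1']
  refine H1.trans ?_
  change Path.Homotopic ((δ.map (continuous_qq n)).cast hex hex1) _
  rw [e2, ← e3]
  exact H3

lemma gen_order {n k : ℕ} (h : gen n ^ k = 1) : (n + 1) ∣ k := by
  let m : Fin (n + 1) → ℤ := Pi.single 0 (k : ℤ)
  have hm : cl (stdLoop m) = 1 := by
    rw [cl_stdLoop]
    simpa [m] using h
  rw [← cl_refl] at hm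
  have hh := cl_eq.1 hm
  let u : unitInterval → ℂ := fun t =>
    Complex.exp (-(((t : ℝ) : ℂ) * k * (2 * Real.pi * Complex.I) / (n + 1 : ℕ)))
  have hu : Continuous u := by fun_prop
  let A : unitInterval → Matrix (Fin (n + 1)) (Fin (n + 1)) ℂ := fun t =>
    u t • (expd (((t : ℝ) : ℂ) • vz m)).1
  have hA : Continuous A :=
    hu.smul (continuous_subtype_val.comp (continuous_expd.comp (by fun_prop)))
  have hdet : ∀ t, (A t).det = 1 := by
    intro t
    have hn : ((n : ℂ) + 1) ≠ 0 := by exact_mod_cast Nat.succ_ne_zero n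
    simp only [A, Matrix.det_smul, expd, Matrix.det_diagonal, ← Complex.exp_sum, u,
      Fintype.card_fin, ← Complex.exp_nat_mul, ← Complex.exp_add]
    rw [← Complex.exp_zero]
    congr 1
    have : ∑ i, (((t : ℝ) : ℂ) • vz m) i = ((t : ℝ) : ℂ) * k * (2 * Real.pi * Complex.I) := by
      rw [Finset.sum_eq_single 0]
      · simp [vz, m]; ring
      · intro j _ hj
        simp [vz, m, hj]
      · simp
    rw [this]
    push_cast
    field_simp
    ring
  let Γ : C(unitInterval, SE (n + 1)) :=
    ⟨fun t => ⟨A t, (expd _).2.1.smul _, hdet t⟩, hA.subtype_mk _⟩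
  have hlift : cv n ∘ Γ = (stdLoop m).toContinuousMap := by
    ext t
    change qq n _ = qq n _
    symm
    rw [qq_eq]
    exact ⟨Units.mk0 (u t) (Complex.exp_ne_zero _), rfl⟩
  have hΓ0 : Γ 0 = e1 n := by
    apply Subtype.ext
    simp [Γ, A, u, e1, expd]
  have h0 : (stdLoop m).toContinuousMap 0 = cv n (e1 n) := by
    rw [cv_e1]; exact (stdLoop m).source
  have h0' : (Path.refl (x0 n)).toContinuousMap 0 = cv n (e1 n) := by
    rw [cv_e1]; rfl
  have key := (isCoveringMap_cv n).liftPath_apply_one_eq_of_homotopicRel hh (e1 n) h0 h0'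
  rw [← ((isCoveringMap_cv n).eq_liftPath_iff' h0).2 ⟨hlift, hΓ0⟩,
    ← ((isCoveringMap_cv n).eq_liftPath_iff' (Γ := ContinuousMap.const _ (e1 n)) h0').2
      ⟨by ext t; exact cv_e1 n, rfl⟩] at key
  have key2 := congrFun (congrFun (congrArg Subtype.val key) 0) 0
  simp [Γ, A, u, e1, expd, vz, m] at key2
  rw [Complex.exp_neg, inv_eq_one, Complex.exp_eq_one_iff] at key2
  obtain ⟨z, hz⟩ := key2
  have hn : ((n : ℂ) + 1) ≠ 0 := by exact_mod_cast Nat.succ_ne_zero n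
  have hz2 : (k : ℂ) = z * (n + 1) := by
    have hpi : (2 * Real.pi * Complex.I : ℂ) ≠ 0 := Complex.two_pi_I_ne_zero
    apply mul_right_cancel₀ hpi
    rw [div_eq_iff hn] at hz
    rw [hz]; ring
  have hz3 : (k : ℤ) = z * (n + 1) := by exact_mod_cast hz2
  have : ((n + 1 : ℕ) : ℤ) ∣ (k : ℤ) := ⟨z, by rw [hz3]; push_cast; ring⟩
  exact_mod_cast this

open Polynomial in
lemma joined_x0 {n : ℕ} (x : QX n) : Joined (x0 n) x := by
  induction x using Quotient.inductionOn with
  | h A =>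
    let p : ℂ[X] := Matrix.det ((1 : Matrix (Fin (n + 1)) (Fin (n + 1)) ℂ[X]) +
      (X : ℂ[X]) • (A.1 - 1).map Polynomial.C)
    have hp : ∀ z, p.eval z = (1 + z • (A.1 - 1)).det := by
      intro z
      rw [← Polynomial.coe_evalRingHom, RingHom.map_det]
      congr 1
      ext i j
      by_cases hij : i = j
      · subst hij
        simp
      · simp [hij]
        exact mul_comm _ _
    obtain ⟨s, -, -, hs⟩ := arc_avoid p (by rw [hp]; simp) (by rw [hp]; simpa using A.2.2) 1 one_pos
    have hc : Continuous fun t : unitInterval => (1 : Matrix (Fin (n + 1)) (Fin (n + 1)) ℂ) +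
      (((t : ℝ) : ℂ) + Complex.I * s * (t : ℝ) * (1 - (t : ℝ))) • (A.1 - 1) := by fun_prop
    refine ⟨⟨⟨fun t => qq n ⟨_, Matrix.isSymm_one.add ((A.2.1.sub Matrix.isSymm_one).smul _),
      (hp _) ▸ hs t⟩, (continuous_qq n).comp (hc.subtype_mk _)⟩, ?_, ?_⟩⟩
    · rw [← cv_e1]
      change qq n _ = qq n _
      congr 1
      apply Subtype.ext
      simp [e1, incl]
    · change qq n _ = qq n A
      congr 1
      apply Subtype.ext
      simp

/-- For `n ≥ 1`, the space `Qu₀(n)` of nonsingular quadrics in `ℂPⁿ`, i.e. the space of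
complex symmetric `(n+1)×(n+1)` matrices with nonzero determinant up to scaling, is
path-connected with fundamental group `ℤ/(n+1)ℤ` at any basepoint. -/
theorem nonsingular_quadrics_pi1 (n : ℕ) (hn : 1 ≤ n) :
    PathConnectedSpace (MatQuot (n + 1) (fun A => A.IsSymm ∧ A.det ≠ 0)) ∧
    ∀ q : MatQuot (n + 1) (fun A => A.IsSymm ∧ A.det ≠ 0),
      Nonempty
        (FundamentalGroup (MatQuot (n + 1) (fun A => A.IsSymm ∧ A.det ≠ 0)) q
          ≃* Multiplicative (ZMod (n + 1))) := by
  have hpc : PathConnectedSpace (QX n) :=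
    ⟨⟨x0 n⟩, fun x y => (joined_x0 x).symm.trans (joined_x0 y)⟩
  refine ⟨hpc, fun q => ?_⟩
  have hz : ∀ g : FundamentalGroup (QX n) (x0 n), g ∈ Subgroup.zpowers (gen n) := fun g =>
    Subgroup.mem_zpowers_iff.2 (all_gen g)
  have hcyc : IsCyclic (FundamentalGroup (QX n) (x0 n)) := ⟨gen n, hz⟩
  have hord : orderOf (gen n) = n + 1 :=
    Nat.dvd_antisymm (orderOf_dvd_of_pow_eq_one (gen_pow n)) (gen_order (pow_orderOf_eq_one _))
  have hcard : Nat.card (FundamentalGroup (QX n) (x0 n)) = n + 1 :=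
    (orderOf_eq_card_of_forall_mem_zpowers hz).symm.trans hord
  have e := zmodCyclicMulEquiv hcyc
  rw [hcard] at e
  exact ⟨(FundamentalGroup.fundamentalGroupMulEquivOfPathConnected q (x0 n)).trans e.symm⟩
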